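/- Every stratified circuit C = (I, L, R, F, P) has at least one reset state; more precisely, for every assignment of Boolean values to the inputs I there exists a reset state of C extending that input assignment. -/

import Mathlib

namespace Cert

variable {V : Type}

/-- `g` semantically depends only on the variables in `S`:
its value is the same on any two assignments agreeing on `S`. -/
def DependsOnlyOn (g : (V → Bool) → Bool) (S : Set V) : Prop :=
  ∀ σ τ : V → Bool, (∀ v ∈ S, σ v = τ v) → g σ = g τ

/-- A circuit `C = (I, L, R, F, P)`: disjoint finite sets of input and latch
variables, a reset and a transition function for each latch, and a property,
all semantically depending only on `I ∪ L`. -/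
structure Circuit (V : Type) where
  inputs : Finset V
  latches : Finset V
  disj : Disjoint inputs latches
  reset : V → (V → Bool) → Bool
  trans : V → (V → Bool) → Bool
  prop : (V → Bool) → Bool
  reset_dep : ∀ l ∈ latches, DependsOnlyOn (reset l) (↑inputs ∪ ↑latches)
  trans_dep : ∀ l ∈ latches, DependsOnlyOn (trans l) (↑inputs ∪ ↑latches)
  prop_dep : DependsOnlyOn prop (↑inputs ∪ ↑latches)

namespace Circuit

/-- The set of variables of a circuit. -/
def vars (C : Circuit V) : Set V := ↑C.inputs ∪ ↑C.latches

/-- `σ` is a reset state of `C`. -/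
def ResetState (C : Circuit V) (σ : V → Bool) : Prop :=
  ∀ l ∈ C.latches, σ l = C.reset l σ

/-- `τ` is a successor of `σ` in `C`. -/
def Succ (C : Circuit V) (σ τ : V → Bool) : Prop :=
  ∀ l ∈ C.latches, τ l = C.trans l σ

/-- `τ` is reachable in `C`: obtained from some reset state by finitely many
successor steps. -/
def Reachable (C : Circuit V) (τ : V → Bool) : Prop :=
  ∃ σ : V → Bool, C.ResetState σ ∧ Relation.ReflTransGen C.Succ σ τ

/-- `C` is safe: the property holds in every reachable state. -/
def Safe (C : Circuit V) : Prop :=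
  ∀ σ : V → Bool, C.Reachable σ → C.prop σ = true

/-- `C` is stratified: there is a well-founded strict order `≺` on the latches
such that every reset function `r_l` semantically depends only on
`I ∪ {k ∈ L | k ≺ l}`. -/
def Stratified (C : Circuit V) : Prop :=
  ∃ lt : V → V → Prop, WellFounded lt ∧ Transitive lt ∧
    ∀ l ∈ C.latches,
      DependsOnlyOn (C.reset l) (↑C.inputs ∪ {k : V | k ∈ C.latches ∧ lt k l})

end Circuit

/-- `W` simulates `C` under the restricted simulation relation:
(1) reset and (2) transition functions agree on common latches, and
(3) the property of `W` implies the property of `C`. -/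
def Simulates (W C : Circuit V) : Prop :=
  (∀ l, l ∈ C.latches → l ∈ W.latches → ∀ σ : V → Bool, C.reset l σ = W.reset l σ) ∧
  (∀ l, l ∈ C.latches → l ∈ W.latches → ∀ σ : V → Bool, C.trans l σ = W.trans l σ) ∧
  (∀ σ : V → Bool, W.prop σ = true → C.prop σ = true)

/-- `Q` is an inductive invariant of `W`. -/
def InductiveInvariant (W : Circuit V) (Q : (V → Bool) → Prop) : Prop :=
  (∀ σ : V → Bool, W.ResetState σ → Q σ) ∧
  (∀ σ τ : V → Bool, Q σ → W.Succ σ τ → Q τ)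

/-- `W` is a witness circuit of `C`: a stratified circuit that simulates `C`
under restricted simulation and whose property is an inductive invariant. -/
def Witness (W C : Circuit V) : Prop :=
  W.Stratified ∧ Simulates W C ∧ InductiveInvariant W (fun σ => W.prop σ = true)

/-- every stratified circuit has a reset state extending any
given assignment of Boolean values to the inputs. -/
theorem statement12 (C : Circuit V) (hC : C.Stratified) (σ : V → Bool) :
    ∃ τ : V → Bool, C.ResetState τ ∧ ∀ x ∈ C.inputs, τ x = σ x := by
  classical
  obtain ⟨lt, hwf, -, hdep⟩ := hC
  let step : ∀ l : V, (∀ k : V, lt k l → Bool) → Bool := fun l ih =>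
    if l ∈ C.latches then C.reset l (fun k => if h : lt k l then ih k h else σ k) else σ l
  have hfix : ∀ l, hwf.fix step l = step l (fun k _ => hwf.fix step k) :=
    fun l => hwf.fix_eq step l
  have hin : ∀ x ∈ C.inputs, hwf.fix step x = σ x := by
    intro x hx
    rw [hfix]
    exact if_neg (Finset.disjoint_left.mp C.disj hx)
  refine ⟨hwf.fix step, fun l hl => ?_, hin⟩
  rw [hfix]
  refine (if_pos hl).trans (hdep l hl _ _ ?_)
  rintro k (hk | ⟨-, hkl⟩)
  · by_cases h : lt k l
    · exact dif_pos h
    · exact (dif_neg h).trans (hin k hk).symm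
  · exact dif_pos hkl

end Cert
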